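/- Let F be an absolutely continuous probability distribution on ℝ with density f, let t > 0 and α ∈ (0,1). Let M and N be independent Poisson random variables with parameters αt and (1−α)t, and conditionally on M = m ≥ 1 and N = n ≥ 1, let L be distributed as the n-th order statistic of an i.i.d. sample of size n+m from F. Then, conditionally on the event {M ≥ 1, N ≥ 1}, L has probability density f_L given for all x ∈ ℝ by f_L(x) = (e^{αt}−1)^{-1} (e^{(1−α)t}−1)^{-1} f(x) · Σ_{n=1}^∞ ((1−α)t)^n/n! · F(x)^{n−1}/(n−1)! · Σ_{m=1}^∞ (n+m)! (αt)^m/m! · (1−F(x))^m/m!. -/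

import Mathlib

open MeasureTheory ProbabilityTheory

/-- A set whose outer measure and that of its complement add up to at most the total (finite)
mass is null-measurable. -/
theorem nullMeasurableSet_of_measure_add_compl_le {Ω : Type*} [MeasurableSpace Ω]
    {μ : Measure Ω} [IsFiniteMeasure μ] {s : Set Ω} (h : μ s + μ sᶜ ≤ μ Set.univ) :
    NullMeasurableSet s μ := by
  have hs : s ⊆ toMeasurable μ s := subset_toMeasurable μ s
  have hc : sᶜ ⊆ toMeasurable μ sᶜ := subset_toMeasurable μ sᶜ
  have hunion : toMeasurable μ s ∪ toMeasurable μ sᶜ = Set.univ := by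
    rw [← Set.univ_subset_iff, ← Set.union_compl_self s]
    exact Set.union_subset_union hs hc
  have hadd := measure_union_add_inter (μ := μ) (toMeasurable μ s)
    (measurableSet_toMeasurable μ sᶜ)
  rw [hunion, measure_toMeasurable, measure_toMeasurable] at hadd
  have hzero : μ (toMeasurable μ s ∩ toMeasurable μ sᶜ) = 0 := by
    have hle : μ Set.univ + μ (toMeasurable μ s ∩ toMeasurable μ sᶜ) ≤ μ Set.univ + 0 := by
      rw [hadd, add_zero]; exact h
    exact nonpos_iff_eq_zero.mp ((ENNReal.add_le_add_iff_left (measure_ne_top μ _)).mp hle)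
  refine ⟨toMeasurable μ s, measurableSet_toMeasurable μ s, ?_⟩
  refine Filter.EventuallyLE.antisymm hs.eventuallyLE (ae_le_set.mpr ?_)
  refine measure_mono_null ?_ hzero
  rintro ω ⟨hω, hω'⟩
  exact ⟨hω, hc hω'⟩

/-- If the masses of the fibres of a countably valued (not necessarily measurable) map sum to at
most the total mass, then all fibres are null-measurable. -/
theorem nullMeasurableSet_fiber_of_tsum_le {Ω ι : Type*} [MeasurableSpace Ω] [Countable ι]
    {μ : Measure Ω} [IsFiniteMeasure μ] {X : Ω → ι}
    (h : ∑' i, μ {ω | X ω = i} ≤ μ Set.univ) (i : ι) :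
    NullMeasurableSet {ω | X ω = i} μ := by
  classical
  refine nullMeasurableSet_of_measure_add_compl_le (le_trans ?_ h)
  rw [ENNReal.tsum_eq_add_tsum_ite i]
  gcongr
  calc μ {ω | X ω = i}ᶜ ≤ μ (⋃ j, if j = i then ∅ else {ω | X ω = j}) := by
        refine measure_mono fun ω hω => Set.mem_iUnion.mpr ⟨X ω, ?_⟩
        have hne : X ω ≠ i := hω
        rw [if_neg hne]
        rfl
    _ ≤ ∑' j, μ (if j = i then ∅ else {ω | X ω = j}) := measure_iUnion_le _
    _ = ∑' j, if j = i then 0 else μ {ω | X ω = j} := by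
        refine tsum_congr fun j => ?_
        split_ifs <;> simp

/-- The outer measure of an arbitrary set is additive along a countable disjoint family of
null-measurable sets. -/
theorem measure_inter_iUnion_of_nullMeasurableSet {Ω ι : Type*} [MeasurableSpace Ω] [Countable ι]
    {μ : Measure Ω} (E : Set Ω) {A : ι → Set Ω} (hd : Pairwise (Function.onFun Disjoint A))
    (hA : ∀ i, NullMeasurableSet (A i) μ) :
    μ (E ∩ ⋃ i, A i) = ∑' i, μ (E ∩ A i) := by
  have hA' : ∀ i, NullMeasurableSet (A i) (μ.restrict E) := fun i =>
    (hA i).mono_ac Measure.absolutelyContinuous_restrict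
  have h := measure_iUnion₀ (hd.mono fun _ _ h => h.aedisjoint) hA'
  rw [Measure.restrict_apply₀ (.iUnion hA')] at h
  simp_rw [fun i => Measure.restrict_apply₀ (hA' i)] at h
  simpa only [Set.inter_comm] using h

theorem hasSum_poisson (r : ℝ) :
    HasSum (fun n : ℕ => Real.exp (-r) * r ^ n / (n.factorial : ℝ)) 1 := by
  have h := (NormedSpace.expSeries_div_hasSum_exp r).mul_left (Real.exp (-r))
  rw [← Real.exp_eq_exp_ℝ, ← Real.exp_add, neg_add_cancel, Real.exp_zero] at h
  simpa only [mul_div_assoc] using h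

theorem hasSum_poisson_succ (r : ℝ) :
    HasSum (fun n : ℕ => Real.exp (-r) * r ^ (n + 1) / ((n + 1).factorial : ℝ))
      (1 - Real.exp (-r)) := by
  simpa using (hasSum_nat_add_iff' 1).mpr (hasSum_poisson r)

theorem tsum_ofReal_poisson {r : ℝ} (hr : 0 ≤ r) :
    ∑' n : ℕ, ENNReal.ofReal (Real.exp (-r) * r ^ n / (n.factorial : ℝ)) = 1 := by
  rw [← ENNReal.ofReal_tsum_of_nonneg (fun n => by positivity) (hasSum_poisson r).summable,
    (hasSum_poisson r).tsum_eq, ENNReal.ofReal_one]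

/-- The double series term in the density of the lower clearing price, as a function of the
value `y` of the distribution function, indexed by `(n, m)` for `n + 1` bids and `m + 1` asks. -/
noncomputable def clearingTerm (a b : ℝ) (p : ℕ × ℕ) (y : ℝ) : ℝ :=
  b ^ (p.1 + 1) / ((p.1 + 1).factorial : ℝ) * (y ^ p.1 / (p.1.factorial : ℝ)) *
    ((((p.1 + 1) + (p.2 + 1)).factorial : ℝ) * (a ^ (p.2 + 1) / ((p.2 + 1).factorial : ℝ)) *
      ((1 - y) ^ (p.2 + 1) / ((p.2 + 1).factorial : ℝ)))

/-- A summable majorant of `clearingTerm`, uniform in `y ∈ [0, 1]`. -/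
noncomputable def clearingBound (a b : ℝ) (p : ℕ × ℕ) : ℝ :=
  (2 * b) * ((2 * b) ^ p.1 / (p.1.factorial : ℝ)) *
    ((2 * a) ^ (p.2 + 1) / ((p.2 + 1).factorial : ℝ))

theorem summable_clearingBound {a b : ℝ} (ha : 0 ≤ a) (hb : 0 ≤ b) :
    Summable (clearingBound a b) := by
  have h1 := (Real.summable_pow_div_factorial (2 * b)).mul_left (2 * b)
  have h2 := (summable_nat_add_iff 1).mpr (Real.summable_pow_div_factorial (2 * a))
  exact h1.mul_of_nonneg h2 (fun n => by positivity) (fun n => by positivity)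

theorem clearingTerm_nonneg {a b y : ℝ} (ha : 0 ≤ a) (hb : 0 ≤ b) (hy : y ∈ Set.Icc (0 : ℝ) 1)
    (p : ℕ × ℕ) : 0 ≤ clearingTerm a b p y := by
  have h0 := hy.1
  have h1 : 0 ≤ 1 - y := sub_nonneg.mpr hy.2
  unfold clearingTerm
  positivity

theorem factorial_add_le (n m : ℕ) :
    ((n + m).factorial : ℝ) ≤ 2 ^ (n + m) * (n.factorial * m.factorial) := by
  rw [← Nat.add_choose_mul_factorial_mul_factorial n m, Nat.cast_mul, Nat.cast_mul, mul_assoc]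
  gcongr
  exact_mod_cast Nat.choose_le_two_pow (n + m) m

theorem clearingTerm_le_clearingBound {a b y : ℝ} (ha : 0 ≤ a) (hb : 0 ≤ b)
    (hy : y ∈ Set.Icc (0 : ℝ) 1) (p : ℕ × ℕ) : clearingTerm a b p y ≤ clearingBound a b p := by
  obtain ⟨n, m⟩ := p
  have hy1 : y ^ n ≤ 1 := pow_le_one₀ hy.1 hy.2
  have hy2 : (1 - y) ^ (m + 1) ≤ 1 :=
    pow_le_one₀ (sub_nonneg.mpr hy.2) (sub_le_self 1 hy.1)
  have h0 : 0 ≤ y ^ n := pow_nonneg hy.1 n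
  have h1 : 0 ≤ (1 - y) ^ (m + 1) := pow_nonneg (sub_nonneg.mpr hy.2) _
  calc clearingTerm a b (n, m) y
      ≤ b ^ (n + 1) / ((n + 1).factorial : ℝ) * (1 / (n.factorial : ℝ)) *
        ((2 ^ ((n + 1) + (m + 1)) * ((n + 1).factorial * (m + 1).factorial)) *
          (a ^ (m + 1) / ((m + 1).factorial : ℝ)) * (1 / ((m + 1).factorial : ℝ))) := by
        unfold clearingTerm
        have := factorial_add_le (n + 1) (m + 1)
        gcongr
    _ = clearingBound a b (n, m) := by
        unfold clearingBound
        have : ((n + 1).factorial : ℝ) ≠ 0 := by positivity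
        have : ((m + 1).factorial : ℝ) ≠ 0 := by positivity
        have : (n.factorial : ℝ) ≠ 0 := by positivity
        field_simp
        ring

theorem summable_clearingTerm {a b y : ℝ} (ha : 0 ≤ a) (hb : 0 ≤ b)
    (hy : y ∈ Set.Icc (0 : ℝ) 1) : Summable fun p => clearingTerm a b p y :=
  (summable_clearingBound ha hb).of_nonneg_of_le (clearingTerm_nonneg ha hb hy)
    (clearingTerm_le_clearingBound ha hb hy)

/-- Termwise integration of the clearing price series against an integrable density. -/
theorem hasSum_integral_clearingTerm {X : Type*} [MeasurableSpace X] {ν : Measure X} {a b : ℝ}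
    (ha : 0 ≤ a) (hb : 0 ≤ b) {f F : X → ℝ} (hf0 : ∀ x, 0 ≤ f x) (hf : Integrable f ν)
    (hFm : Measurable F) (hF : ∀ x, F x ∈ Set.Icc (0 : ℝ) 1) :
    HasSum (fun p => ∫ u, clearingTerm a b p (F u) * f u ∂ν)
      (∫ u, (∑' p, clearingTerm a b p (F u)) * f u ∂ν) := by
  have hint : ∀ p, Integrable (fun u => clearingTerm a b p (F u) * f u) ν := fun p => by
    refine hf.bdd_mul (c := clearingBound a b p) ?_ (.of_forall fun u => ?_)
    · unfold clearingTerm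
      exact Measurable.aestronglyMeasurable (by fun_prop)
    · rw [Real.norm_of_nonneg (clearingTerm_nonneg ha hb (hF u) p)]
      exact clearingTerm_le_clearingBound ha hb (hF u) p
  simp_rw [← tsum_mul_right]
  refine hasSum_integral_of_summable_integral_norm hint ?_
  refine ((summable_clearingBound ha hb).mul_right (∫ u, f u ∂ν)).of_nonneg_of_le
    (fun p => by positivity) fun p => ?_
  rw [← integral_const_mul]
  refine integral_mono (hint p).norm (hf.const_mul _) fun u => ?_
  dsimp only
  rw [Real.norm_of_nonneg (mul_nonneg (clearingTerm_nonneg ha hb (hF u) p) (hf0 u))]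
  exact mul_le_mul_of_nonneg_right (clearingTerm_le_clearingBound ha hb (hF u) p) (hf0 u)

/-- Let `F` be an absolutely continuous distribution on `ℝ` with density `f`,
let `t > 0` and `α ∈ (0,1)`.  Let `M`, `N` be independent Poisson random variables with
parameters `αt` and `(1−α)t` and, conditionally on `M = m ≥ 1`, `N = n ≥ 1`, let `L` be
distributed as the `n`-th order statistic of an i.i.d. `(n+m)`-sample from `F` (whose density
is `x ↦ (n+m)!/((n−1)! m!) F(x)^{n−1} (1−F(x))^m f(x)`).  Then, conditionally on
`{M ≥ 1, N ≥ 1}`, `L` has the density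
`f_L(x) = (e^{αt}−1)⁻¹ (e^{(1−α)t}−1)⁻¹ f(x)
  Σ_{n≥1} ((1−α)t)^n/n! · F(x)^{n−1}/(n−1)! Σ_{m≥1} (n+m)! (αt)^m/m! (1−F(x))^m/m!`
(the sums over `n ≥ 1`, `m ≥ 1` being written with the shifts `n = n'+1`, `m = m'+1`). -/
theorem stmt_9 {Ω : Type*} [MeasurableSpace Ω] (μ : Measure Ω) [IsProbabilityMeasure μ]
    (t α : ℝ) (ht : 0 < t) (hα : α ∈ Set.Ioo (0 : ℝ) 1)
    (f : ℝ → ℝ) (hf0 : ∀ x, 0 ≤ f x) (hf1 : ∫ x, f x = 1)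
    (F : ℝ → ℝ) (hF : ∀ x, F x = ∫ u in Set.Iic x, f u)
    (M N : Ω → ℕ) (L : Ω → ℝ)
    (hM : ∀ m : ℕ,
      μ {ω | M ω = m}
        = ENNReal.ofReal (Real.exp (-(α * t)) * (α * t) ^ m / (m.factorial : ℝ)))
    (hN : ∀ n : ℕ,
      μ {ω | N ω = n}
        = ENNReal.ofReal (Real.exp (-((1 - α) * t)) * ((1 - α) * t) ^ n / (n.factorial : ℝ)))
    (hindep : ∀ m n : ℕ, μ {ω | M ω = m ∧ N ω = n} = μ {ω | M ω = m} * μ {ω | N ω = n})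
    (hL : ∀ m n : ℕ, 1 ≤ m → 1 ≤ n → ∀ x : ℝ,
      μ {ω | L ω ≤ x ∧ M ω = m ∧ N ω = n}
        = μ {ω | M ω = m ∧ N ω = n} *
            ENNReal.ofReal (∫ u in Set.Iic x,
              (((n + m).factorial : ℝ) / (((n - 1).factorial : ℝ) * (m.factorial : ℝ))) *
                F u ^ (n - 1) * (1 - F u) ^ m * f u)) :
    ∀ x : ℝ,
      μ {ω | L ω ≤ x ∧ 1 ≤ M ω ∧ 1 ≤ N ω}
        = μ {ω | 1 ≤ M ω ∧ 1 ≤ N ω} *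
            ENNReal.ofReal (∫ u in Set.Iic x,
              (Real.exp (α * t) - 1)⁻¹ * (Real.exp ((1 - α) * t) - 1)⁻¹ * f u *
                ∑' (n : ℕ),
                  (((1 - α) * t) ^ (n + 1) / ((n + 1).factorial : ℝ)) *
                    (F u ^ n / (n.factorial : ℝ)) *
                    ∑' (m : ℕ),
                      (((n + 1) + (m + 1)).factorial : ℝ) *
                        ((α * t) ^ (m + 1) / ((m + 1).factorial : ℝ)) *
                        ((1 - F u) ^ (m + 1) / ((m + 1).factorial : ℝ))) := by
  intro x
  obtain ⟨hα0, hα1⟩ := hα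
  set a := α * t
  set b := (1 - α) * t
  have ha : 0 < a := mul_pos hα0 ht
  have hb : 0 < b := mul_pos (sub_pos.mpr hα1) ht
  have hfint : Integrable f := integrable_of_integral_eq_one hf1
  have hF01 : ∀ u, F u ∈ Set.Icc (0 : ℝ) 1 := fun u => by
    rw [hF u]
    refine ⟨integral_nonneg hf0, hf1 ▸ ?_⟩
    exact setIntegral_le_integral hfint (.of_forall hf0)
  have hFm : Measurable F := by
    refine Monotone.measurable fun u v huv => ?_
    rw [hF u, hF v]
    exact setIntegral_mono_set hfint.integrableOn (.of_forall hf0)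
      (Set.Iic_subset_Iic.mpr huv).eventuallyLE
  have hMnull : ∀ m, NullMeasurableSet {ω | M ω = m} μ := by
    refine nullMeasurableSet_fiber_of_tsum_le ?_
    simp_rw [hM, measure_univ]
    exact (tsum_ofReal_poisson ha.le).le
  have hNnull : ∀ n, NullMeasurableSet {ω | N ω = n} μ := by
    refine nullMeasurableSet_fiber_of_tsum_le ?_
    simp_rw [hN, measure_univ]
    exact (tsum_ofReal_poisson hb.le).le
  set A : ℕ × ℕ → Set Ω := fun p => {ω | M ω = p.2 + 1 ∧ N ω = p.1 + 1} with hA_def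
  have hAnull : ∀ p, NullMeasurableSet (A p) μ := fun p =>
    (hMnull (p.2 + 1)).inter (hNnull (p.1 + 1))
  have hAdisj : Pairwise (Function.onFun Disjoint A) := fun p q hpq => by
    refine Set.disjoint_left.mpr fun ω hp hq => hpq ?_
    obtain ⟨hp1, hp2⟩ := hp
    obtain ⟨hq1, hq2⟩ := hq
    exact Prod.ext (by omega) (by omega)
  have hAunion : ⋃ p, A p = {ω | 1 ≤ M ω ∧ 1 ≤ N ω} := by
    ext ω
    simp only [hA_def, Set.mem_iUnion, Set.mem_ofPred_eq, Prod.exists]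
    constructor
    · rintro ⟨n, m, h1, h2⟩
      omega
    · rintro ⟨h1, h2⟩
      exact ⟨N ω - 1, M ω - 1, by omega, by omega⟩
  have hAmeas : ∀ p, μ (A p) = ENNReal.ofReal
      ((Real.exp (-b) * b ^ (p.1 + 1) / ((p.1 + 1).factorial : ℝ)) *
        (Real.exp (-a) * a ^ (p.2 + 1) / ((p.2 + 1).factorial : ℝ))) := fun p => by
    rw [hA_def, hindep, hM, hN, mul_comm, ENNReal.ofReal_mul (by positivity)]
  have hevent : μ {ω | 1 ≤ M ω ∧ 1 ≤ N ω} =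
      ENNReal.ofReal ((1 - Real.exp (-b)) * (1 - Real.exp (-a))) := by
    have h := measure_inter_iUnion_of_nullMeasurableSet (μ := μ) Set.univ hAdisj hAnull
    simp only [Set.univ_inter] at h
    have hb' := hasSum_poisson_succ b
    have ha' := hasSum_poisson_succ a
    have hprod := hb'.summable.mul_of_nonneg ha'.summable
      (fun n => by positivity) (fun n => by positivity)
    rw [← hAunion, h, ← (hb'.mul ha' hprod).tsum_eq]
    simp_rw [hAmeas]
    exact (ENNReal.ofReal_tsum_of_nonneg (fun p => by positivity) hprod).symm
  have hterm : ∀ p, μ ({ω | L ω ≤ x} ∩ A p) = ENNReal.ofReal (Real.exp (-a) * Real.exp (-b) *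
      ∫ u in Set.Iic x, clearingTerm a b p (F u) * f u) := fun p => by
    refine (hL (p.2 + 1) (p.1 + 1) (by omega) (by omega) x).trans ?_
    change μ (A p) * _ = _
    rw [hAmeas, ← ENNReal.ofReal_mul (by positivity), ← integral_const_mul, ← integral_const_mul]
    refine congrArg _ (integral_congr_ae (.of_forall fun u => ?_))
    simp only [clearingTerm, Nat.add_sub_cancel]
    field_simp
  have hsum := hasSum_integral_clearingTerm (ν := volume.restrict (Set.Iic x)) ha.le hb.le hf0
    hfint.restrict hFm hF01
  have hleft : μ {ω | L ω ≤ x ∧ 1 ≤ M ω ∧ 1 ≤ N ω} =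
      ENNReal.ofReal (Real.exp (-a) * Real.exp (-b) *
        ∫ u in Set.Iic x, (∑' p, clearingTerm a b p (F u)) * f u) := by
    have h := measure_inter_iUnion_of_nullMeasurableSet (μ := μ) {ω | L ω ≤ x} hAdisj hAnull
    rw [hAunion] at h
    refine h.trans ?_
    have hsum' := hsum.mul_left (Real.exp (-a) * Real.exp (-b))
    rw [← hsum'.tsum_eq]
    simp_rw [hterm]
    refine (ENNReal.ofReal_tsum_of_nonneg (fun p => ?_) hsum'.summable).symm
    exact mul_nonneg (by positivity) (integral_nonneg fun u =>
      mul_nonneg (clearingTerm_nonneg ha.le hb.le (hF01 u) p) (hf0 u))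
  have hexpa : Real.exp a - 1 ≠ 0 := (sub_pos.mpr (Real.one_lt_exp_iff.mpr ha)).ne'
  have hexpb : Real.exp b - 1 ≠ 0 := (sub_pos.mpr (Real.one_lt_exp_iff.mpr hb)).ne'
  have hnn : 0 ≤ (1 - Real.exp (-b)) * (1 - Real.exp (-a)) :=
    mul_nonneg (sub_nonneg.mpr (Real.exp_le_one_iff.mpr (by linarith)))
      (sub_nonneg.mpr (Real.exp_le_one_iff.mpr (by linarith)))
  rw [hleft, hevent, ← ENNReal.ofReal_mul hnn, ← integral_const_mul, ← integral_const_mul]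
  refine congrArg _ (integral_congr_ae (.of_forall fun u => ?_))
  have hnested : ∑' p, clearingTerm a b p (F u) =
      ∑' n : ℕ, (b ^ (n + 1) / ((n + 1).factorial : ℝ)) * (F u ^ n / (n.factorial : ℝ)) *
        ∑' m : ℕ, (((n + 1) + (m + 1)).factorial : ℝ) *
          (a ^ (m + 1) / ((m + 1).factorial : ℝ)) *
          ((1 - F u) ^ (m + 1) / ((m + 1).factorial : ℝ)) := by
    rw [(summable_clearingTerm ha.le hb.le (hF01 u)).tsum_prod]
    simp only [clearingTerm, tsum_mul_left]
  dsimp only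
  rw [← hnested, Real.exp_neg, Real.exp_neg]
  field_simp
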